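/- arXiv:1611.04102 — 2 statements merged into one kernel-verified Lean document; each statement's English description precedes it below -/
import Mathlib

section
/- For every integer m ≥ 2, ζ(m) = ((−1)^m/m) ∫_{Ω_m} ( ∑_{j=0}^{m−1} ξ_m^j log x_{j+1} )^m dx, where ξ_m = exp(2πi/m) and Ω_m is the open standard simplex {x_i > 0, x_1+...+x_m = 1}. -/
open MeasureTheory

noncomputable def zsW (y : ℝ) : ℝ := (Set.Ioi (0:ℝ)).indicator (fun y => Real.exp (-y)) y

noncomputable def zsK {m : ℕ} (y : Fin m → ℝ) : ℝ := ∏ j, zsW (y j)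

noncomputable def zsF {m : ℕ} (c : Fin m → ℂ) (y : Fin m → ℝ) : ℂ :=
  ∑ j, c j * Complex.log (y j)

noncomputable def zsA {m : ℕ} (y : Fin m → ℝ) : ℝ := ∑ j, ‖Complex.log (y j)‖

lemma zsW_nonneg (y : ℝ) : 0 ≤ zsW y := by
  unfold zsW
  exact Set.indicator_nonneg (fun _ _ => (Real.exp_pos _).le) _

lemma zsW_meas : Measurable zsW := by
  unfold zsW
  exact (Real.measurable_exp.comp measurable_neg).indicator measurableSet_Ioi

lemma zsK_nonneg {m : ℕ} (y : Fin m → ℝ) : 0 ≤ zsK y :=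
  Finset.prod_nonneg fun _ _ => zsW_nonneg _

lemma zsK_meas {m : ℕ} : Measurable (zsK (m := m)) := by
  unfold zsK
  exact Finset.measurable_prod _ fun j _ => zsW_meas.comp (measurable_pi_apply j)

lemma zsLog_meas : Measurable (fun y : ℝ => Complex.log (y : ℂ)) :=
  Complex.measurable_log.comp Complex.measurable_ofReal

lemma zsF_meas {m : ℕ} (c : Fin m → ℂ) : Measurable (zsF c) := by
  unfold zsF
  exact Finset.measurable_fun_sum _ fun j _ =>
    (zsLog_meas.comp (measurable_pi_apply j)).const_mul _

lemma zsA_meas {m : ℕ} : Measurable (zsA (m := m)) := by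
  unfold zsA
  exact Finset.measurable_fun_sum _ fun j _ =>
    (zsLog_meas.comp (measurable_pi_apply j)).norm

lemma zsA_nonneg {m : ℕ} (y : Fin m → ℝ) : 0 ≤ zsA y :=
  Finset.sum_nonneg fun _ _ => norm_nonneg _

lemma zsF_le {m : ℕ} (c : Fin m → ℂ) (hc : ∀ j, ‖c j‖ ≤ 1) (y : Fin m → ℝ) :
    ‖zsF c y‖ ≤ zsA y := by
  unfold zsF zsA
  refine (norm_sum_le _ _).trans (Finset.sum_le_sum fun j _ => ?_)
  rw [norm_mul]
  exact mul_le_of_le_one_left (norm_nonneg _) (hc j)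

lemma zs_one_int (r : ℝ) (h0 : 0 ≤ r) (h1 : r < 1) :
    Integrable (fun y : ℝ => zsW y * Real.exp (r * ‖Complex.log (y:ℂ)‖)) := by
  have hA := (Real.GammaIntegral_convergent (s := 1 + r) (by linarith))
  have hB := (Real.GammaIntegral_convergent (s := 1 - r) (by linarith))
  have hAB := (hA.add hB).integrable_indicator measurableSet_Ioi
  refine hAB.mono' ?_ ?_
  · exact (zsW_meas.mul (Real.measurable_exp.comp
      ((zsLog_meas.norm).const_mul _))).aestronglyMeasurable
  · refine Filter.Eventually.of_forall fun y => ?_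
    by_cases hy : 0 < y
    · have hy' : y ∈ Set.Ioi (0:ℝ) := hy
      simp only [zsW, Set.indicator_of_mem hy']
      rw [← Complex.ofReal_log hy.le, Complex.norm_real, Real.norm_eq_abs, Real.norm_eq_abs,
        abs_of_nonneg (by positivity)]
      simp only [Pi.add_apply]
      rw [← mul_add]
      refine mul_le_mul_of_nonneg_left ?_ (Real.exp_pos _).le
      rw [Real.rpow_def_of_pos hy, Real.rpow_def_of_pos hy]
      rcases abs_cases (Real.log y) with ⟨h, _⟩ | ⟨h, _⟩ <;> rw [h]
      · have : r * Real.log y = Real.log y * (1 + r - 1) := by ring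
        rw [this]
        linarith [Real.exp_pos (Real.log y * (1 - r - 1))]
      · have : r * -Real.log y = Real.log y * (1 - r - 1) := by ring
        rw [this]
        linarith [Real.exp_pos (Real.log y * (1 + r - 1))]
    · have hy' : y ∉ Set.Ioi (0:ℝ) := hy
      simp [zsW, hy]

lemma zs_int {m : ℕ} (r : ℝ) (h0 : 0 ≤ r) (h1 : r < 1) :
    Integrable (fun y : Fin m → ℝ => zsK y * Real.exp (r * zsA y)) := by
  have := Integrable.fintype_prod (ι := Fin m) (μ := fun _ => (volume : Measure ℝ))
    (f := fun _ y => zsW y * Real.exp (r * ‖Complex.log (y:ℂ)‖)) (fun _ => zs_one_int r h0 h1)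
  rw [volume_pi]
  refine this.congr (Filter.Eventually.of_forall fun y => ?_)
  simp only [Finset.prod_mul_distrib, zsK, zsA, Finset.mul_sum, Real.exp_sum]

lemma zs_hasSum {m : ℕ} (c : Fin m → ℂ) (hc : ∀ j, ‖c j‖ ≤ 1) (t : ℂ) (ht : ‖t‖ < 1) :
    HasSum (fun k : ℕ => ∫ y : Fin m → ℝ, (zsK y : ℂ) * ((t * zsF c y) ^ k / (k.factorial : ℂ)))
      (∫ y : Fin m → ℝ, (zsK y : ℂ) * Complex.exp (t * zsF c y)) := by
  have hs : ∀ x : ℝ, HasSum (fun k : ℕ => x ^ k / (k.factorial : ℝ)) (Real.exp x) := by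
    intro x
    rw [Real.exp_eq_exp_ℝ]
    exact NormedSpace.expSeries_div_hasSum_exp x
  refine hasSum_integral_of_dominated_convergence
    (fun k y => zsK y * ((‖t‖ * zsA y) ^ k / (k.factorial : ℝ))) ?_ ?_ ?_ ?_ ?_
  · intro k
    have h1 := zsK_meas (m := m)
    have h2 := zsF_meas c
    exact (by fun_prop : Measurable _).aestronglyMeasurable
  · refine fun k => Filter.Eventually.of_forall fun y => ?_
    rw [norm_mul, norm_div, norm_pow, norm_mul, Complex.norm_real, Real.norm_eq_abs,
      abs_of_nonneg (zsK_nonneg y), Complex.norm_natCast]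
    have := zsF_le c hc y
    have := zsK_nonneg y
    gcongr
  · exact Filter.Eventually.of_forall fun y => ((hs _).mul_left _).summable
  · refine (zs_int (m := m) ‖t‖ (norm_nonneg _) ht).congr
      (Filter.Eventually.of_forall fun y => ?_)
    exact ((hs _).mul_left _).tsum_eq.symm
  · refine Filter.Eventually.of_forall fun y => ?_
    refine HasSum.mul_left _ ?_
    rw [Complex.exp_eq_exp_ℂ]
    exact NormedSpace.expSeries_div_hasSum_exp _

lemma zs_int_pow {m : ℕ} (c : Fin m → ℂ) (hc : ∀ j, ‖c j‖ ≤ 1) (k : ℕ) :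
    Integrable (fun y : Fin m → ℝ => (zsK y : ℂ) * zsF c y ^ k) := by
  have h := (zs_int (m := m) (1/2) (by norm_num) (by norm_num)).const_mul
    (2 ^ k * (k.factorial : ℝ))
  refine h.mono' ?_ (Filter.Eventually.of_forall fun y => ?_)
  · have h1 := zsK_meas (m := m)
    have h2 := zsF_meas c
    exact (by fun_prop : Measurable _).aestronglyMeasurable
  · rw [norm_mul, norm_pow, Complex.norm_real, Real.norm_eq_abs,
      abs_of_nonneg (zsK_nonneg y)]
    have h1 := zsF_le c hc y
    have h2 := zsK_nonneg y
    have h3 := zsA_nonneg y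
    have h4 := Real.pow_div_factorial_le_exp (1/2 * zsA y) (by positivity) k
    rw [div_le_iff₀ (by positivity), mul_pow, one_div, inv_pow, inv_mul_le_iff₀ (by positivity)] at h4
    calc zsK y * ‖zsF c y‖ ^ k ≤ zsK y * zsA y ^ k := by gcongr
      _ ≤ zsK y * (2 ^ k * (Real.exp (2⁻¹ * zsA y) * k.factorial)) := by gcongr
      _ = _ := by ring_nf

lemma zs_gamma {m : ℕ} (c : Fin m → ℂ) (hc : ∀ j, ‖c j‖ ≤ 1) (t : ℂ) (ht : ‖t‖ < 1) :
    ∫ y : Fin m → ℝ, (zsK y : ℂ) * Complex.exp (t * zsF c y) =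
      ∏ j, Complex.Gamma (1 + t * c j) := by
  have h1 : ∀ j, Complex.Gamma (1 + t * c j) =
      ∫ y : ℝ, (zsW y : ℂ) * Complex.exp (t * (c j * Complex.log (y:ℂ))) := by
    intro j
    have hre : 0 < (1 + t * c j).re := by
      have h2 : ‖t * c j‖ < 1 := by
        rw [norm_mul]
        exact (mul_le_of_le_one_right (norm_nonneg _) (hc j)).trans_lt ht
      have h3 := (abs_le.1 (Complex.abs_re_le_norm (t * c j))).1
      simp only [Complex.add_re, Complex.one_re]
      linarith
    rw [Complex.Gamma_eq_integral hre, Complex.GammaIntegral,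
      ← integral_indicator measurableSet_Ioi]
    congr 1
    ext y
    by_cases hy : 0 < y
    · have hy' : y ∈ Set.Ioi (0:ℝ) := hy
      simp only [zsW, Set.indicator_of_mem hy']
      rw [Complex.cpow_def_of_ne_zero (by exact_mod_cast hy.ne')]
      congr 2
      ring
    · simp [zsW, hy]
  simp_rw [h1]
  rw [← integral_fintype_prod_volume_eq_prod (fun (j : Fin m) (y : ℝ) =>
    (zsW y : ℂ) * Complex.exp (t * (c j * Complex.log (y:ℂ))))]
  congr 1
  ext y
  rw [Finset.prod_mul_distrib, ← Complex.exp_sum, zsK, zsF, Finset.mul_sum]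
  push_cast
  rfl

lemma zsK_pos {m : ℕ} (y : Fin m → ℝ) (hy : ∀ j, 0 < y j) : zsK y = Real.exp (-∑ j, y j) := by
  rw [zsK, ← Finset.sum_neg_distrib, Real.exp_sum]
  refine Finset.prod_congr rfl fun j _ => ?_
  have : y j ∈ Set.Ioi (0:ℝ) := hy j
  simp only [zsW, Set.indicator_of_mem this]

lemma zsK_zero {m : ℕ} (y : Fin m → ℝ) (hy : ¬ ∀ j, 0 < y j) : zsK y = 0 := by
  push Not at hy
  obtain ⟨j, hj⟩ := hy
  refine Finset.prod_eq_zero (Finset.mem_univ j) ?_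
  simp [zsW, hj]

lemma zs_snoc_pos {n : ℕ} (x : Fin n → ℝ) (r : ℝ) :
    (∀ j, 0 < (Fin.snoc x r : Fin (n+1) → ℝ) j) ↔ (∀ i, 0 < x i) ∧ 0 < r := by
  constructor
  · intro h
    refine ⟨fun i => ?_, ?_⟩
    · simpa using h i.castSucc
    · simpa using h (Fin.last n)
  · rintro ⟨h1, h2⟩ j
    induction j using Fin.lastCases with
    | last => simpa using h2
    | cast i => simpa using h1 i

lemma zs_snoc_smul {n : ℕ} (x : Fin n → ℝ) (r s : ℝ) :
    (Fin.snoc (s • x) (s * r) : Fin (n+1) → ℝ) = s • (Fin.snoc x r : Fin (n+1) → ℝ) := by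
  ext j
  induction j using Fin.lastCases with
  | last => simp
  | cast i => simp

lemma zs_simplex (n : ℕ) (G : (Fin (n+1) → ℝ) → ℂ)
    (hG : ∀ s : ℝ, 0 < s → ∀ y, (∀ j, 0 < y j) → G (s • y) = G y)
    (hint : Integrable (fun y => (zsK y : ℂ) * G y)) :
    ∫ y, (zsK y : ℂ) * G y = (n.factorial : ℂ) *
      ∫ x : Fin n → ℝ in {x : Fin n → ℝ | (∀ i, 0 < x i) ∧ ∑ i, x i < 1},
        G (Fin.snoc x (1 - ∑ i, x i)) := by
  set H : (Fin (n+1) → ℝ) → ℂ := fun y => (zsK y : ℂ) * G y with hH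
  set Ω : Set (Fin n → ℝ) := {x : Fin n → ℝ | (∀ i, 0 < x i) ∧ ∑ i, x i < 1} with hΩ
  have hΩm : MeasurableSet Ω := by
    have h1 : MeasurableSet {x : Fin n → ℝ | ∀ i, 0 < x i} := by
      rw [Set.ofPred_forall]
      exact MeasurableSet.iInter fun i => measurableSet_lt measurable_const (measurable_pi_apply i)
    have h2 : MeasurableSet {x : Fin n → ℝ | ∑ i, x i < 1} :=
      measurableSet_lt (Finset.measurable_fun_sum _ fun i _ => measurable_pi_apply i)
        measurable_const
    exact h1.inter h2
  have hmp := (volume_preserving_piFinSuccAbove (fun _ : Fin (n+1) => ℝ) (Fin.last n)).symm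
  have he : ∀ p : ℝ × (Fin n → ℝ),
      (MeasurableEquiv.piFinSuccAbove (fun _ : Fin (n+1) => ℝ) (Fin.last n)).symm p
        = (Fin.snoc p.2 p.1 : Fin (n+1) → ℝ) := by
    intro p
    simp [MeasurableEquiv.piFinSuccAbove, Fin.insertNthEquiv]
  have hint2 : Integrable (fun p : ℝ × (Fin n → ℝ) => H (Fin.snoc p.2 p.1)) := by
    have := hmp.integrable_comp_of_integrable hint
    refine this.congr (Filter.Eventually.of_forall fun p => ?_)
    simp only [Function.comp, he]
  have e1 : ∫ y, H y = ∫ p : ℝ × (Fin n → ℝ), H (Fin.snoc p.2 p.1) := by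
    rw [← hmp.integral_comp' H]
    simp only [he]
  have hsk : MeasurePreserving (fun p : (Fin n → ℝ) × ℝ => (p.1, p.2 - ∑ i, p.1 i))
      (volume.prod volume) (volume.prod volume) := by
    refine MeasurePreserving.skew_product (f := id) (g := fun (x : Fin n → ℝ) (s : ℝ) => s - ∑ i, x i)
      (MeasurePreserving.id _) ?_ ?_
    · have : Measurable fun x : Fin n → ℝ => ∑ i, x i :=
        Finset.measurable_fun_sum _ fun i _ => measurable_pi_apply i
      exact measurable_snd.sub (this.comp measurable_fst)
    · exact Filter.Eventually.of_forall fun x =>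
        (measurePreserving_sub_right volume (∑ i, x i)).map_eq
  have hint3 : Integrable (Function.uncurry fun (x : Fin n → ℝ) (s : ℝ) =>
      H (Fin.snoc x (s - ∑ i, x i))) (volume.prod volume) := by
    have := hsk.integrable_comp_of_integrable hint2.swap
    exact this
  have e2 : ∫ p : ℝ × (Fin n → ℝ), H (Fin.snoc p.2 p.1) =
      ∫ s : ℝ, ∫ x : Fin n → ℝ, H (Fin.snoc x (s - ∑ i, x i)) := by
    rw [← integral_integral_swap hint3]
    rw [show (volume : Measure (ℝ × (Fin n → ℝ))) = volume.prod volume from rfl,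
      integral_prod_symm _ hint2]
    congr 1
    ext x
    exact (integral_sub_right_eq_self (fun r => H (Fin.snoc x r)) (∑ i, x i)).symm
  have e3 : ∀ s : ℝ, ∫ x : Fin n → ℝ, H (Fin.snoc x (s - ∑ i, x i)) =
      (Set.Ioi (0:ℝ)).indicator (fun s => (((Real.exp (-s) * s ^ n : ℝ)) : ℂ) *
        ∫ x in Ω, G (Fin.snoc x (1 - ∑ i, x i))) s := by
    intro s
    by_cases hs : 0 < s
    · have hs' : s ∈ Set.Ioi (0:ℝ) := hs
      rw [Set.indicator_of_mem hs']
      have h1 := Measure.integral_comp_smul (volume : Measure (Fin n → ℝ))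
        (fun x => H (Fin.snoc x (s - ∑ i, x i))) s
      rw [Module.finrank_fin_fun, abs_of_nonneg (by positivity)] at h1
      have h2 : ∀ x : Fin n → ℝ, H (Fin.snoc (s • x) (s - ∑ i, (s • x) i)) =
          Ω.indicator (fun x => ((Real.exp (-s) : ℝ) : ℂ) * G (Fin.snoc x (1 - ∑ i, x i))) x := by
        intro x
        have h3 : s - ∑ i, (s • x) i = s * (1 - ∑ i, x i) := by
          simp only [Pi.smul_apply, smul_eq_mul, ← Finset.mul_sum]
          ring
        rw [h3, zs_snoc_smul]
        have h4 : x ∈ Ω ↔ ∀ j, 0 < (Fin.snoc x (1 - ∑ i, x i) : Fin (n+1) → ℝ) j := by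
          rw [zs_snoc_pos, sub_pos]
          rfl
        by_cases hx : x ∈ Ω
        · rw [Set.indicator_of_mem hx]
          have hx' := h4.1 hx
          simp only [hH]
          rw [hG s hs _ hx', zsK_pos]
          · congr 3
            simp only [Pi.smul_apply, smul_eq_mul, ← Finset.mul_sum]
            rw [Fin.sum_univ_castSucc]
            simp
          · intro j
            exact mul_pos hs (hx' j)
        · rw [Set.indicator_of_notMem hx]
          simp only [hH]
          rw [zsK_zero]
          · simp
          · intro h
            refine hx (h4.2 fun j => ?_)
            have := h j
            simp only [Pi.smul_apply, smul_eq_mul] at this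
            exact (mul_pos_iff_of_pos_left hs).1 this
      simp_rw [h2] at h1
      rw [integral_indicator hΩm, integral_const_mul] at h1
      have h5 : ∫ x : Fin n → ℝ, H (Fin.snoc x (s - ∑ i, x i)) = ((s ^ n : ℝ) : ℂ) *
          ((s ^ n)⁻¹ • ∫ x : Fin n → ℝ, H (Fin.snoc x (s - ∑ i, x i))) := by
        rw [Complex.real_smul, ← mul_assoc, ← Complex.ofReal_mul,
          mul_inv_cancel₀ (by positivity)]
        simp
      rw [h5, ← h1]
      push_cast
      ring
    · have hs' : s ∉ Set.Ioi (0:ℝ) := hs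
      rw [Set.indicator_of_notMem hs']
      have : ∀ x : Fin n → ℝ, H (Fin.snoc x (s - ∑ i, x i)) = 0 := by
        intro x
        simp only [hH]
        rw [zsK_zero]
        · simp
        · rw [zs_snoc_pos]
          rintro ⟨h1, h2⟩
          have := Finset.sum_nonneg (s := Finset.univ) (f := x) fun i _ => (h1 i).le
          linarith
      simp [this]
  rw [e1, e2]
  simp_rw [e3]
  rw [integral_indicator measurableSet_Ioi, integral_mul_const, integral_complex_ofReal]
  congr 1
  have := Real.Gamma_eq_integral (s := n + 1) (by positivity)
  rw [Real.Gamma_nat_eq_factorial] at this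
  rw [← Complex.ofReal_natCast, this]
  congr 1
  refine setIntegral_congr_fun measurableSet_Ioi fun x _ => ?_
  simp

lemma zs_root_prod (n : ℕ) (ξ : ℂ) (hξ : IsPrimitiveRoot ξ (n+1)) (x t : ℂ) :
    ∏ j : Fin (n+1), (t * ξ ^ (j:ℕ) + x) = x ^ (n+1) - (-t) ^ (n+1) := by
  rw [hξ.pow_sub_pow_eq_prod_sub_mul x (-t) (Nat.succ_pos n),
    Fin.prod_univ_eq_prod_range (fun j => t * ξ ^ j + x) (n+1)]
  symm
  have : Polynomial.nthRootsFinset (n+1) (1:ℂ) = (Finset.range (n+1)).image (fun i => ξ ^ i) := by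
    ext z
    rw [Polynomial.mem_nthRootsFinset (Nat.succ_pos n), Finset.mem_image]
    constructor
    · intro h
      obtain ⟨i, hi, h⟩ := hξ.eq_pow_of_pow_eq_one h
      exact ⟨i, Finset.mem_range.2 hi, h⟩
    · rintro ⟨i, _, rfl⟩
      rw [← pow_mul, mul_comm, pow_mul, hξ.pow_eq_one, one_pow]
  rw [this, Finset.prod_image]
  · refine Finset.prod_congr rfl fun i _ => ?_
    ring
  · intro i hi j hj h
    exact hξ.pow_inj (by simpa using hi) (by simpa using hj) h

lemma zs_lim (n : ℕ) (hn : 1 ≤ n) (ξ : ℂ) (hξ : IsPrimitiveRoot ξ (n+1)) (t : ℂ) (ht : t ≠ 0) :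
    Filter.Tendsto (fun N : ℕ => ∏ i ∈ Finset.range N, (1 - (-t) ^ (n+1) / ((i:ℂ) + 1) ^ (n+1))⁻¹)
      Filter.atTop (nhds (∏ j : Fin (n+1), Complex.Gamma (1 + t * ξ ^ (j:ℕ)))) := by
  have hξ0 : ξ ≠ 0 := hξ.ne_zero (Nat.succ_ne_zero n)
  have hz : ∀ j : Fin (n+1), t * ξ ^ (j:ℕ) ≠ 0 := fun j => mul_ne_zero ht (pow_ne_zero _ hξ0)
  have h1 : Filter.Tendsto (fun N : ℕ => ∏ j : Fin (n+1),
      ((t * ξ ^ (j:ℕ)) * Complex.GammaSeq (t * ξ ^ (j:ℕ)) N)) Filter.atTop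
      (nhds (∏ j : Fin (n+1), Complex.Gamma (1 + t * ξ ^ (j:ℕ)))) := by
    refine tendsto_finsetProd _ fun j _ => ?_
    rw [add_comm 1 (t * ξ ^ (j:ℕ)), Complex.Gamma_add_one _ (hz j)]
    exact (Complex.GammaSeq_tendsto_Gamma _).const_mul _
  refine h1.congr' ?_
  filter_upwards [Filter.eventually_ge_atTop 1] with N hN
  have hN0 : (N:ℂ) ≠ 0 := by exact_mod_cast (by omega : N ≠ 0)
  have hsum : ∑ j : Fin (n+1), t * ξ ^ (j:ℕ) = 0 := by
    rw [← Finset.mul_sum, Fin.sum_univ_eq_sum_range (fun j => ξ ^ j) (n+1),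
      hξ.geom_sum_eq_zero (by omega), mul_zero]
  unfold Complex.GammaSeq
  rw [Finset.prod_mul_distrib (f := fun j : Fin (n+1) => t * ξ ^ (j:ℕ)), Finset.prod_div_distrib,
    Finset.prod_mul_distrib (f := fun j : Fin (n+1) => (N:ℂ) ^ (t * ξ ^ (j:ℕ))),
    Finset.prod_comm]
  have h2 : ∏ j : Fin (n+1), (N:ℂ) ^ (t * ξ ^ (j:ℕ)) = 1 := by
    simp_rw [Complex.cpow_def_of_ne_zero hN0]
    rw [← Complex.exp_sum, ← Finset.mul_sum, hsum]
    simp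
  rw [h2, Finset.prod_range_succ']
  simp_rw [zs_root_prod n ξ hξ]
  have h3 : ∏ j : Fin (n+1), (t * ξ ^ (j:ℕ)) = ((0:ℕ):ℂ) ^ (n+1) - (-t) ^ (n+1) := by
    rw [← zs_root_prod n ξ hξ]
    simp
  have h4 : ((0:ℕ):ℂ) ^ (n+1) - (-t) ^ (n+1) ≠ 0 := by
    rw [← h3]
    exact Finset.prod_ne_zero_iff.2 fun j _ => hz j
  rw [h3, one_mul, mul_div_assoc', mul_comm _ (((0:ℕ):ℂ) ^ (n+1) - (-t) ^ (n+1)),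
    mul_div_mul_left _ _ h4,
    Finset.prod_const, Finset.card_univ, Fintype.card_fin,
    ← Finset.prod_range_add_one_eq_factorial]
  push_cast
  rw [← Finset.prod_pow, ← Finset.prod_div_distrib]
  refine Finset.prod_congr rfl fun i _ => ?_
  have h5 : ((i:ℂ) + 1) ^ (n+1) ≠ 0 := pow_ne_zero _ (by exact_mod_cast Nat.succ_ne_zero i)
  rw [one_sub_div h5, inv_div]

/-- elementary bounds -/
lemma zs_bound (a : ℕ → ℝ) (h0 : ∀ i, 0 ≤ a i) (N : ℕ) (h1 : ∑ i ∈ Finset.range N, a i < 1) :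
    1 + ∑ i ∈ Finset.range N, a i ≤ ∏ i ∈ Finset.range N, (1 - a i)⁻¹ ∧
    ∏ i ∈ Finset.range N, (1 - a i)⁻¹ ≤ (1 - ∑ i ∈ Finset.range N, a i)⁻¹ := by
  induction N with
  | zero => simp
  | succ N ih =>
    rw [Finset.sum_range_succ] at *
    rw [Finset.prod_range_succ]
    have hS : 0 ≤ ∑ i ∈ Finset.range N, a i := Finset.sum_nonneg fun i _ => h0 i
    have hN := h0 N
    obtain ⟨l, u⟩ := ih (by linarith)
    set S := ∑ i ∈ Finset.range N, a i
    have hp : 0 < 1 - a N := by linarith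
    have hq : 0 < 1 - S := by linarith
    have h2 : 1 + a N ≤ (1 - a N)⁻¹ := by
      rw [le_inv_comm₀ (by linarith) hp, inv_eq_one_div, le_div_iff₀ (by linarith)]
      nlinarith
    constructor
    · calc 1 + (S + a N) ≤ (1 + S) * (1 + a N) := by nlinarith
        _ ≤ _ := by
          have hP : 0 ≤ ∏ i ∈ Finset.range N, (1 - a i)⁻¹ := by linarith
          gcongr
    · calc _ ≤ (1 - S)⁻¹ * (1 - a N)⁻¹ := by gcongr
        _ = ((1 - S) * (1 - a N))⁻¹ := by rw [mul_inv]
        _ ≤ _ := by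
          apply inv_anti₀ (by linarith)
          nlinarith

lemma zs_real_lim (n : ℕ) (hn : 1 ≤ n) (Z : ℝ)
    (hZ : HasSum (fun i : ℕ => 1 / ((i:ℝ) + 1) ^ (n+1)) Z) (u : ℝ) (hu : 0 < u) (huZ : u * Z < 1)
    (L : ℂ) (hL : Filter.Tendsto (fun N : ℕ => ∏ i ∈ Finset.range N,
      (1 - (u:ℂ) / ((i:ℂ) + 1) ^ (n+1))⁻¹) Filter.atTop (nhds L)) :
    L.im = 0 ∧ 1 + u * Z ≤ L.re ∧ L.re ≤ (1 - u * Z)⁻¹ := by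
  have hc : ∀ N : ℕ, ∏ i ∈ Finset.range N, (1 - (u:ℂ) / ((i:ℂ) + 1) ^ (n+1))⁻¹ =
      ((∏ i ∈ Finset.range N, (1 - u * (1 / ((i:ℝ) + 1) ^ (n+1)))⁻¹ : ℝ) : ℂ) := by
    intro N
    push_cast
    simp only [mul_one_div]
  simp_rw [hc] at hL
  have him := (Complex.continuous_im.tendsto L).comp hL
  have hre := (Complex.continuous_re.tendsto L).comp hL
  simp only [Function.comp_def, Complex.ofReal_im, Complex.ofReal_re] at him hre
  have hs := hZ.mul_left u
  have hsN := hs.tendsto_sum_nat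
  have hle : ∀ N, ∑ i ∈ Finset.range N, u * (1 / ((i:ℝ) + 1) ^ (n+1)) ≤ u * Z := fun N =>
    sum_le_hasSum _ (fun i _ => by positivity) hs
  have hb := fun N => zs_bound (fun i => u * (1 / ((i:ℝ) + 1) ^ (n+1)))
    (fun i => by positivity) N ((hle N).trans_lt huZ)
  refine ⟨tendsto_nhds_unique him tendsto_const_nhds |>.trans rfl, ?_, ?_⟩
  · exact le_of_tendsto_of_tendsto' (hsN.const_add 1) hre fun N => (hb N).1
  · exact le_of_tendsto_of_tendsto' hre
      ((hsN.const_sub 1).inv₀ (by linarith)) fun N => (hb N).2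

lemma zs_main (n : ℕ) (hn : 1 ≤ n) (ξ : ℂ) (hξ : IsPrimitiveRoot ξ (n+1)) (Z : ℝ)
    (hZ : HasSum (fun i : ℕ => 1 / ((i:ℝ) + 1) ^ (n+1)) Z) :
    (-1) ^ (n+1) * ((∫ y : Fin (n+1) → ℝ, (zsK y : ℂ) *
      zsF (fun j : Fin (n+1) => ξ ^ (j:ℕ)) y ^ (n+1)) / ((n+1).factorial : ℂ)) = (Z : ℂ) := by
  set c : Fin (n+1) → ℂ := fun j => ξ ^ (j:ℕ) with hcdef
  have hξ1 : ‖ξ‖ = 1 := hξ.norm'_eq_one (Nat.succ_ne_zero n)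
  have hc : ∀ j, ‖c j‖ ≤ 1 := fun j => by simp [hcdef, hξ1]
  set a : ℕ → ℂ := fun k => (∫ y : Fin (n+1) → ℝ, (zsK y : ℂ) * zsF c y ^ k) / (k.factorial : ℂ)
    with ha
  set f : ℂ → ℂ := fun t => ∏ j : Fin (n+1), Complex.Gamma (1 + t * ξ ^ (j:ℕ)) with hf
  have hS : ∀ t : ℂ, ‖t‖ < 1 → HasSum (fun k : ℕ => t ^ k * a k) (f t) := by
    intro t ht
    have := zs_hasSum c hc t ht
    rw [zs_gamma c hc t ht] at this
    refine this.congr_fun ?_ |> id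
    intro k
    simp only [ha]
    rw [← integral_div, ← integral_const_mul]
    congr 1
    ext y
    ring
  have hinv : ∀ (t : ℂ) (i : ℕ), f (t * ξ ^ i) = f t := by
    intro t i
    by_cases ht : t = 0
    · simp [ht]
    · have h1 := zs_lim n hn ξ hξ t ht
      have h2 := zs_lim n hn ξ hξ (t * ξ ^ i)
        (mul_ne_zero ht (pow_ne_zero _ (hξ.ne_zero (Nat.succ_ne_zero n))))
      have h3 : (-(t * ξ ^ i)) ^ (n+1) = (-t) ^ (n+1) := by
        rw [← neg_mul, mul_pow, ← pow_mul, mul_comm i, pow_mul, hξ.pow_eq_one, one_pow, mul_one]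
      rw [h3] at h2
      exact tendsto_nhds_unique h2 h1
  set b : ℕ → ℂ := fun q => a ((n+1) * q) with hb
  have hn0 : ((n:ℂ) + 1) ≠ 0 := by exact_mod_cast Nat.succ_ne_zero n
  have hT : ∀ t : ℂ, ‖t‖ < 1 → HasSum (fun q : ℕ => (t ^ (n+1)) ^ q * b q) (f t) := by
    intro t ht
    have h1 : HasSum (fun k : ℕ => ∑ i ∈ Finset.range (n+1), (t * ξ ^ i) ^ k * a k)
        (∑ i ∈ Finset.range (n+1), f (t * ξ ^ i)) := by
      refine hasSum_sum fun i _ => hS _ ?_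
      simpa [hξ1] using ht
    simp_rw [hinv] at h1
    rw [Finset.sum_const, Finset.card_range, nsmul_eq_mul] at h1
    have h2 := h1.mul_left ((n:ℂ) + 1)⁻¹
    push_cast at h2
    rw [← mul_assoc, inv_mul_cancel₀ hn0, one_mul] at h2
    have hinj : Function.Injective fun q : ℕ => (n+1) * q :=
      fun p q h => Nat.eq_of_mul_eq_mul_left (Nat.succ_pos n) h
    rw [← hinj.hasSum_iff] at h2
    · refine h2.congr_fun ?_ |> id
      intro q
      simp only [Function.comp, hb]
      have : ∀ i ∈ Finset.range (n+1), (t * ξ ^ i) ^ ((n+1) * q) * a ((n+1) * q) =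
          (t ^ (n+1)) ^ q * a ((n+1) * q) := by
        intro i _
        rw [mul_pow, ← pow_mul ξ, mul_comm i, mul_assoc (n+1), pow_mul ξ, hξ.pow_eq_one, one_pow,
          mul_one, pow_mul]
      rw [Finset.sum_congr rfl this, Finset.sum_const, Finset.card_range, nsmul_eq_mul]
      push_cast
      rw [← mul_assoc, inv_mul_cancel₀ hn0, one_mul]
    · intro k hk
      have hk' : ¬ (n+1) ∣ k := by
        rintro ⟨q, rfl⟩
        exact hk ⟨q, rfl⟩
      have h3 : ξ ^ k ≠ 1 := fun h => hk' ((hξ.pow_eq_one_iff_dvd k).1 h)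
      have h4 : ∑ i ∈ Finset.range (n+1), (ξ ^ k) ^ i = 0 := by
        rw [geom_sum_eq h3, ← pow_mul, mul_comm, pow_mul, hξ.pow_eq_one, one_pow, sub_self,
          zero_div]
      have h5 : ∑ i ∈ Finset.range (n+1), (t * ξ ^ i) ^ k * a k =
          t ^ k * a k * ∑ i ∈ Finset.range (n+1), (ξ ^ k) ^ i := by
        rw [Finset.mul_sum]
        refine Finset.sum_congr rfl fun i _ => ?_
        rw [mul_pow, ← pow_mul, ← pow_mul, mul_comm k i]
        ring
      rw [h5, h4]
      simp
  set φ : ℂ → ℂ := fun v => ∑' q, v ^ q * b q with hφ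
  have hφf : ∀ t : ℂ, ‖t‖ < 1 → φ (t ^ (n+1)) = f t := fun t ht => (hT t ht).tsum_eq
  have hφs : ∀ v : ℂ, ‖v‖ < 1 → HasSum (fun q => v ^ q * b q) (φ v) := by
    intro v hv
    obtain ⟨t, rfl⟩ := IsAlgClosed.exists_pow_nat_eq v (Nat.succ_pos n)
    have ht : ‖t‖ < 1 := by
      rw [norm_pow] at hv
      exact (pow_lt_one_iff_of_nonneg (norm_nonneg _) (Nat.succ_ne_zero n)).1 hv
    rw [hφf t ht]
    exact hT t ht
  have hps : HasFPowerSeriesAt φ (FormalMultilinearSeries.ofScalars ℂ b) 0 := by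
    rw [hasFPowerSeriesAt_iff]
    filter_upwards [Metric.ball_mem_nhds (0:ℂ) one_pos] with z hz
    simp only [FormalMultilinearSeries.coeff_ofScalars, zero_add, smul_eq_mul]
    exact hφs z (by simpa using hz)
  have hd : HasDerivAt φ (b 1) 0 := by
    have := hps.hasDerivAt
    simpa [FormalMultilinearSeries.ofScalars] using this
  have hφ0 : φ 0 = 1 := by
    have := hφf 0 (by simp)
    rw [zero_pow (Nat.succ_ne_zero n)] at this
    rw [this]
    simp [hf]
  have hd2 : HasDerivAt (fun u : ℝ => φ ((-1) ^ (n+1) * (u:ℂ))) (b 1 * (-1) ^ (n+1)) 0 := by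
    have h1 : HasDerivAt (fun u : ℂ => (-1 : ℂ) ^ (n+1) * u) ((-1) ^ (n+1)) ((0:ℝ):ℂ) := by
      simpa using (hasDerivAt_id ((0:ℝ):ℂ)).const_mul ((-1 : ℂ) ^ (n+1))
    have h2 : HasDerivAt φ (b 1) ((-1 : ℂ) ^ (n+1) * ((0:ℝ):ℂ)) := by simpa using hd
    exact (h2.comp _ h1).comp_ofReal
  have hsl := hd2.tendsto_slope_zero_right
  simp only [zero_add, Complex.ofReal_zero, mul_zero, hφ0] at hsl
  have hZ0 : 0 ≤ Z := hZ.nonneg fun i => by positivity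
  have hkey : ∀ᶠ u : ℝ in nhdsWithin 0 (Set.Ioi 0),
      0 < u ∧ u * Z < 1 ∧ (φ ((-1) ^ (n+1) * (u:ℂ))).im = 0 ∧
      1 + u * Z ≤ (φ ((-1) ^ (n+1) * (u:ℂ))).re ∧
      (φ ((-1) ^ (n+1) * (u:ℂ))).re ≤ (1 - u * Z)⁻¹ := by
    have h1 : Set.Ioo (0:ℝ) (1 / (Z + 1)) ∈ nhdsWithin (0:ℝ) (Set.Ioi 0) :=
      Ioo_mem_nhdsGT (by positivity)
    filter_upwards [h1] with u hu
    have hu0 := hu.1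
    have hu1 : u * (Z + 1) < 1 := (lt_div_iff₀ (by positivity)).1 hu.2
    have huZ : u * Z < 1 := by nlinarith
    have hu2 : u < 1 := by nlinarith
    refine ⟨hu0, huZ, ?_⟩
    set s : ℝ := u ^ (((n+1 : ℕ) : ℝ)⁻¹) with hs
    have hsp : s ^ (n+1) = u := Real.rpow_inv_natCast_pow hu0.le (Nat.succ_ne_zero n)
    have hs0 : 0 < s := Real.rpow_pos_of_pos hu0 _
    have hs1 : s < 1 := (pow_lt_one_iff_of_nonneg hs0.le (Nat.succ_ne_zero n)).1 (by rwa [hsp])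
    have ht : ‖(-(s:ℂ))‖ < 1 := by
      rw [norm_neg, Complex.norm_real, Real.norm_eq_abs, abs_of_pos hs0]
      exact hs1
    have e1 : (-1) ^ (n+1) * (u:ℂ) = (-(s:ℂ)) ^ (n+1) := by
      rw [neg_pow (s:ℂ), ← Complex.ofReal_pow, hsp]
    rw [e1, hφf _ ht]
    refine zs_real_lim n hn Z hZ u hu0 huZ _ ?_
    have h2 := zs_lim n hn ξ hξ (-(s:ℂ)) (by simpa using hs0.ne')
    rw [neg_neg, ← Complex.ofReal_pow, hsp] at h2
    exact h2
  have him := (Complex.continuous_im.tendsto _).comp hsl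
  have hre := (Complex.continuous_re.tendsto _).comp hsl
  have r1 : (b 1 * (-1) ^ (n+1)).im = 0 := by
    refine tendsto_nhds_unique him (tendsto_const_nhds.congr' ?_)
    filter_upwards [hkey] with u hu
    simp [hu.2.2.1]
  have r2 : (b 1 * (-1) ^ (n+1)).re = Z := by
    refine tendsto_nhds_unique hre ?_
    have hlim : Filter.Tendsto (fun u : ℝ => Z * (1 - u * Z)⁻¹) (nhdsWithin 0 (Set.Ioi 0))
        (nhds Z) := by
      have : ContinuousAt (fun u : ℝ => Z * (1 - u * Z)⁻¹) 0 := by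
        refine ContinuousAt.mul continuousAt_const (ContinuousAt.inv₀ (by fun_prop) (by simp))
      have h := this.tendsto
      simp only [zero_mul, sub_zero, inv_one, mul_one] at h
      exact h.mono_left nhdsWithin_le_nhds
    refine tendsto_of_tendsto_of_tendsto_of_le_of_le' tendsto_const_nhds hlim ?_ ?_
    · filter_upwards [hkey] with u ⟨h0, h1, _, h2, h3⟩
      simp only [Function.comp, Complex.real_smul, Complex.re_ofReal_mul, Complex.sub_re,
        Complex.one_re]
      rw [inv_mul_eq_div, le_div_iff₀ h0]
      linarith
    · filter_upwards [hkey] with u ⟨h0, h1, _, h2, h3⟩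
      simp only [Function.comp, Complex.real_smul, Complex.re_ofReal_mul, Complex.sub_re,
        Complex.one_re]
      rw [inv_mul_eq_div, div_le_iff₀ h0]
      have h4 : (1 - u * Z)⁻¹ - 1 = Z * (1 - u * Z)⁻¹ * u := by
        have : 1 - u * Z ≠ 0 := by linarith
        field_simp
        ring
      linarith
  have hb1 : b 1 = a (n+1) := by simp [hb]
  rw [hb1, mul_comm] at r1 r2
  apply Complex.ext
  · simpa [ha] using r2
  · simpa [ha] using r1

/-- for `m = n+1 ≥ 2`,
`ζ(m) = ((-1)^m/m) ∫_{Ωₘ} (∑_{j<m} ξʲ log x_{j+1})^m dx`. -/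
theorem statement17 (n : ℕ) (hn : 1 ≤ n) :
    (∑' i : ℕ+, (1 : ℂ) / (i : ℂ) ^ (n + 1)) =
      ((-1) ^ (n + 1) / ((n : ℂ) + 1)) *
        ∫ x : Fin n → ℝ in
            {x : Fin n → ℝ | (∀ i, 0 < x i) ∧ ∑ i, x i < 1},
          (∑ j : Fin (n + 1),
              Complex.exp (2 * Real.pi * Complex.I / (n + 1)) ^ (j : ℕ) *
                Complex.log ((Fin.snoc x (1 - ∑ i, x i) : Fin (n + 1) → ℝ) j)) ^
            (n + 1) := by
  have hξ := Complex.isPrimitiveRoot_exp (n+1) (Nat.succ_ne_zero n)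
  push_cast at hξ
  set ξ := Complex.exp (2 * Real.pi * Complex.I / (n + 1)) with hξdef
  have hξ1 : ‖ξ‖ = 1 := hξ.norm'_eq_one (Nat.succ_ne_zero n)
  have hsm : Summable (fun i : ℕ => 1 / ((i:ℝ) + 1) ^ (n+1)) := by
    have := (summable_nat_add_iff 1).2
      ((Real.summable_one_div_nat_pow (p := n+1)).2 (by omega))
    simpa using this
  have hmain := zs_main n hn ξ hξ _ hsm.hasSum
  have hc : ∀ j : Fin (n+1), ‖ξ ^ (j:ℕ)‖ ≤ 1 := fun j => by simp [hξ1]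
  have hsimp := zs_simplex n (fun y => zsF (fun j : Fin (n+1) => ξ ^ (j:ℕ)) y ^ (n+1)) (by
      intro s hs y hy
      have : zsF (fun j : Fin (n+1) => ξ ^ (j:ℕ)) (s • y) =
          zsF (fun j : Fin (n+1) => ξ ^ (j:ℕ)) y := by
        unfold zsF
        have h1 : ∀ j, Complex.log (((s • y) j : ℝ) : ℂ) =
            (Real.log s : ℂ) + Complex.log (y j : ℂ) := by
          intro j
          rw [Pi.smul_apply, smul_eq_mul, Complex.ofReal_mul,
            Complex.log_ofReal_mul hs (by exact_mod_cast (hy j).ne')]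
        simp_rw [h1, mul_add]
        rw [Finset.sum_add_distrib, ← Finset.sum_mul,
          Fin.sum_univ_eq_sum_range (fun j => ξ ^ j) (n+1), hξ.geom_sum_eq_zero (by omega)]
        simp
      simp only [this]) (zs_int_pow _ hc (n+1))
  rw [hsimp] at hmain
  have hl : (∑' i : ℕ+, (1 : ℂ) / (i : ℂ) ^ (n + 1)) =
      ((∑' i : ℕ, 1 / ((i:ℝ) + 1) ^ (n+1) : ℝ) : ℂ) := by
    rw [tsum_pnat_eq_tsum_succ (f := fun i : ℕ => (1:ℂ) / (i:ℂ) ^ (n+1))]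
    push_cast
    rfl
  rw [hl, ← hmain]
  unfold zsF
  have h1 : ((n+1).factorial : ℂ) = ((n:ℂ) + 1) * (n.factorial : ℂ) := by
    rw [Nat.factorial_succ]
    push_cast
    ring
  have h2 : (n.factorial : ℂ) ≠ 0 := by exact_mod_cast n.factorial_ne_zero
  have h3 : ((n:ℂ) + 1) ≠ 0 := by exact_mod_cast Nat.succ_ne_zero n
  rw [h1]
  field_simp
end

section
/- ζ(3) = −(1/3) ∫_0^1 ∫_0^{1−x} ( log x + ω log y + ω² log(1−x−y) )³ dy dx, where ω = exp(2πi/3). -/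
open MeasureTheory Set Filter Topology

/-- integrable on the unit interval with given integral -/
def HI (f : ℝ → ℝ) (c : ℝ) : Prop :=
  IntervalIntegrable f volume 0 1 ∧ ∫ t in (0:ℝ)..1, f t = c

lemma HI.add {f g : ℝ → ℝ} {c d : ℝ} (hf : HI f c) (hg : HI g d) :
    HI (fun t => f t + g t) (c + d) :=
  ⟨hf.1.add hg.1, by rw [intervalIntegral.integral_add hf.1 hg.1, hf.2, hg.2]⟩

lemma HI.smul {f : ℝ → ℝ} {c : ℝ} (a : ℝ) (hf : HI f c) : HI (fun t => a * f t) (a * c) :=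
  ⟨hf.1.const_mul a, by rw [intervalIntegral.integral_const_mul, hf.2]⟩

lemma HI.congr {f g : ℝ → ℝ} {c d : ℝ} (hf : HI f c) (h : ∀ t, 0 < t → t < 1 → f t = g t)
    (hcd : c = d) : HI g d := by
  have h' : EqOn f g (uIoo 0 1) := by
    intro t ht
    rw [uIoo_of_le zero_le_one] at ht
    exact h t ht.1 ht.2
  exact ⟨hf.1.congr_uIoo h', by rw [← intervalIntegral.integral_congr_uIoo h', hf.2, hcd]⟩

lemma HI.symm {f : ℝ → ℝ} {c : ℝ} (hf : HI f c) : HI (fun t => f (1 - t)) c := by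
  refine ⟨?_, ?_⟩
  · have := (hf.1.comp_sub_left 1).symm
    simpa using this
  · rw [intervalIntegral.integral_comp_sub_left]; simpa using hf.2

lemma HI.unique {f : ℝ → ℝ} {c d : ℝ} (hf : HI f c) (hg : HI f d) : c = d := hf.2.symm.trans hg.2

lemma hi_of {f : ℝ → ℝ} (h : IntervalIntegrable f volume 0 1) : HI f (∫ t in (0:ℝ)..1, f t) :=
  ⟨h, rfl⟩

lemma HI.ofReal' {f : ℝ → ℝ} {c : ℝ} (hf : HI f c) :
    IntervalIntegrable (fun t => (f t : ℂ)) volume 0 1 :=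
  ⟨hf.1.1.ofReal, hf.1.2.ofReal⟩

lemma ii_log (n : ℕ) : IntervalIntegrable (fun t => |Real.log t| ^ n) volume 0 1 := by
  rcases Nat.eq_zero_or_pos n with rfl | hn
  · simp
  have hr : IntervalIntegrable (fun t : ℝ => (2 * n : ℝ) ^ n * t ^ (-(1/2) : ℝ)) volume 0 1 :=
    (intervalIntegral.intervalIntegrable_rpow' (by norm_num)).const_mul _
  refine hr.mono_fun' ((Real.measurable_log.norm.pow_const n).aestronglyMeasurable) ?_
  rw [uIoc_of_le zero_le_one]
  refine ae_restrict_of_forall_mem measurableSet_Ioc ?_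
  rintro x ⟨hx, hx1⟩
  have hn' : (0:ℝ) < n := by exact_mod_cast hn
  have h := (Real.abs_log_mul_self_rpow_lt x (1 / (2 * n)) hx hx1 (by positivity)).le
  have hp : 0 < x ^ (1 / (2 * n) : ℝ) := Real.rpow_pos_of_pos hx _
  rw [abs_mul, abs_of_pos hp, one_div_one_div] at h
  have h2 := pow_le_pow_left₀ (by positivity) h n
  rw [mul_pow, ← Real.rpow_natCast (x ^ _), ← Real.rpow_mul hx.le] at h2
  have e : (1 / (2 * n) * n : ℝ) = 1 / 2 := by field_simp
  rw [e] at h2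
  show ‖|Real.log x| ^ n‖ ≤ (2 * n : ℝ) ^ n * x ^ (-(1/2) : ℝ)
  rw [Real.norm_of_nonneg (by positivity), Real.rpow_neg hx.le, ← div_eq_mul_inv, le_div_iff₀ (Real.rpow_pos_of_pos hx _)]
  exact h2

lemma ii_mon (i j : ℕ) :
    IntervalIntegrable (fun t => Real.log t ^ i * Real.log (1 - t) ^ j) volume 0 1 := by
  have h1 := ii_log (i + j)
  have h2 := ((hi_of h1).symm).1
  refine (h1.add h2).mono_fun' ?_ ?_
  · exact Measurable.aestronglyMeasurable (by fun_prop)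
  refine Eventually.of_forall fun t => ?_
  simp only [norm_mul, norm_pow, Real.norm_eq_abs]
  set a := |Real.log t|
  set b := |Real.log (1 - t)|
  have ha : 0 ≤ a := abs_nonneg _
  have hb : 0 ≤ b := abs_nonneg _
  rcases le_total a b with h | h
  · calc a ^ i * b ^ j ≤ b ^ i * b ^ j := by gcongr
      _ = b ^ (i + j) := by ring
      _ ≤ _ := by have : 0 ≤ a ^ (i + j) := by positivity
                  linarith
  · calc a ^ i * b ^ j ≤ a ^ i * a ^ j := by gcongr
      _ = a ^ (i + j) := by ring
      _ ≤ _ := by have : 0 ≤ b ^ (i + j) := by positivity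
                  linarith

lemma ii_mul {f g : ℝ → ℝ} (hg : Continuous g) (hf : IntervalIntegrable f volume 0 1) :
    IntervalIntegrable (fun t => g t * f t) volume 0 1 :=
  hf.continuousOn_mul hg.continuousOn

lemma ii_klog (k n : ℕ) : IntervalIntegrable (fun t => t ^ k * Real.log t ^ n) volume 0 1 := by
  have := ii_mul (g := fun t => t ^ k) (by fun_prop) (ii_mon n 0)
  simpa using this

lemma tend_log (n k : ℕ) :
    Tendsto (fun t : ℝ => t ^ (k+1) * Real.log t ^ (n+1)) (𝓝[>] 0) (𝓝 0) := by
  have h := (tendsto_log_mul_rpow_nhdsGT_zero (r := ((k:ℝ)+1) / (n+1)) (by positivity)).pow (n+1)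
  rw [zero_pow (by omega)] at h
  refine h.congr' ?_
  filter_upwards [self_mem_nhdsWithin] with x hx
  have hx : 0 < x := hx
  rw [mul_pow, ← Real.rpow_natCast (x ^ _), ← Real.rpow_mul hx.le]
  push_cast
  rw [div_mul_cancel₀ _ (by positivity), mul_comm]
  congr 1
  exact_mod_cast Real.rpow_natCast x (k+1)

lemma hi_klog (k n : ℕ) : HI (fun t => t ^ k * Real.log t ^ n)
    ((-1) ^ n * n.factorial / ((k:ℝ) + 1) ^ (n + 1)) := by
  induction n with
  | zero => exact ⟨ii_klog k 0, by simp⟩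
  | succ n ih =>
    refine ⟨ii_klog k _, ?_⟩
    have hA := (hi_of (ii_klog k (n+1)))
    have hB := (hA.smul ((k:ℝ)+1)).add (ih.smul ((n:ℝ)+1))
    have h0 := intervalIntegral.integral_eq_sub_of_hasDerivAt_of_tendsto (a := (0:ℝ)) (b := 1)
      (f := fun t => t ^ (k+1) * Real.log t ^ (n+1)) one_pos (fa := 0) (fb := 0)
      (f' := fun t => ((k:ℝ)+1) * (t ^ k * Real.log t ^ (n+1)) + ((n:ℝ)+1) * (t ^ k * Real.log t ^ n))
      ?_ hB.1 (tend_log n k) ?_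
    · rw [hB.2] at h0
      rw [Nat.factorial_succ]
      push_cast
      have : ((k:ℝ)+1) ≠ 0 := by positivity
      field_simp at h0 ⊢
      rw [pow_succ, pow_succ] 
      linear_combination h0
    · rintro t ⟨ht, _⟩
      have := (hasDerivAt_pow (k+1) t).mul ((Real.hasDerivAt_log ht.ne').pow (n+1))
      refine this.congr_deriv ?_
      have := ht.ne'
      simp
      field_simp
      ring
    · have : ContinuousAt (fun t : ℝ => t ^ (k+1) * Real.log t ^ (n+1)) 1 := by
        have : ContinuousAt Real.log 1 := Real.continuousAt_log one_ne_zero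
        fun_prop
      have := this.tendsto
      simp at this
      exact this.mono_left nhdsWithin_le_nhds

lemma hs (n : ℕ) : HasSum (fun k : ℕ => -(1 / ((k:ℝ)+1)) *
      ((-1) ^ n * n.factorial / (((k:ℝ) + 1) + 1) ^ (n + 1)))
    (∫ t in (0:ℝ)..1, Real.log t ^ n * Real.log (1 - t)) := by
  let F : ℕ → ℝ → ℝ := fun k t => -(1 / ((k:ℝ)+1)) * (t ^ (k+1) * Real.log t ^ n)
  have hF : ∀ k, HI (F k) _ := fun k => (hi_klog (k+1) n).smul (-(1 / ((k:ℝ)+1)))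
  have hint : ∀ k, Integrable (F k) (volume.restrict (Ioc 0 1)) := fun k =>
    (intervalIntegrable_iff_integrableOn_Ioc_of_le zero_le_one).1 (hF k).1
  have hN : ∀ k, HI (fun t => ‖F k t‖) (1 / ((k:ℝ)+1) * (n.factorial / (((k:ℝ) + 1) + 1) ^ (n + 1))) := by
    intro k
    refine ((hF k).smul (-(-1) ^ n)).congr ?_ ?_
    · intro t h0 h1
      have : Real.log t < 0 := Real.log_neg h0 h1
      simp only [F, norm_mul, norm_pow, Real.norm_eq_abs, norm_neg, abs_of_pos h0, abs_of_neg this]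
      rw [abs_of_pos (by positivity), neg_pow (Real.log t)]
      ring
    · have : ((-1:ℝ)^n) * (-1)^n = 1 := by rw [← mul_pow]; simp
      push_cast
      linear_combination (1 / ((k:ℝ)+1) * (n.factorial / (((k:ℝ) + 1) + 1) ^ (n + 1))) * this
  have hsum : Summable fun k => ∫ t in Ioc (0:ℝ) 1, ‖F k t‖ := by
    simp_rw [← intervalIntegral.integral_of_le (zero_le_one (α := ℝ)), fun k => (hN k).2]
    have hs : Summable fun k : ℕ => (n.factorial : ℝ) * (1 / ((k:ℝ)+1)^2) := by
      have := (summable_nat_add_iff 1).2 (Real.summable_one_div_nat_pow.2 (one_lt_two))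
      push_cast at this
      exact this.mul_left _
    refine Summable.of_nonneg_of_le (fun k => by positivity) (fun k => ?_) hs
    have : ((k:ℝ)+1) ≤ (((k:ℝ) + 1) + 1) ^ (n + 1) := by
      calc ((k:ℝ)+1) ≤ (((k:ℝ) + 1) + 1) ^ 1 := by linarith
        _ ≤ _ := pow_le_pow_right₀ (by linarith [Nat.cast_nonneg (α := ℝ) k]) (by omega)
    calc 1 / ((k:ℝ)+1) * (n.factorial / (((k:ℝ) + 1) + 1) ^ (n + 1)) ≤ 1 / ((k:ℝ)+1) * (n.factorial / ((k:ℝ)+1)) := by gcongr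
      _ = _ := by field_simp
  have := hasSum_integral_of_summable_integral_norm hint hsum
  simp_rw [← intervalIntegral.integral_of_le (zero_le_one (α := ℝ)), fun k => (hF k).2] at this
  push_cast at this
  suffices e : (∫ t in (0:ℝ)..1, Real.log t ^ n * Real.log (1 - t)) = ∫ t in (0:ℝ)..1, ∑' k, F k t by
    rw [e]; exact this
  apply intervalIntegral.integral_congr_uIoo
  intro t ht
  rw [uIoo_of_le zero_le_one] at ht
  have h := (Real.hasSum_pow_div_log_of_abs_lt_one (x := t) (by rw [abs_lt]; constructor <;> linarith [ht.1, ht.2])).mul_left (-(Real.log t ^ n))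
  have e : (fun k => F k t) = fun k : ℕ => -(Real.log t ^ n) * (t ^ (k+1) / ((k:ℝ)+1)) := by
    ext k; simp only [F]; ring
  simp only
  rw [e, h.tsum_eq]; ring

lemma JK : HasSum (fun k : ℕ => 1 / ((k:ℝ) + 1 + 1) ^ 3)
    ((∫ t in (0:ℝ)..1, Real.log t * Real.log (1 - t)) +
      (∫ t in (0:ℝ)..1, Real.log t ^ 2 * Real.log (1 - t)) / 2) := by
  have := (hs 1).add ((hs 2).div_const 2)
  simp only [pow_one] at this
  convert this using 1
  ext k
  simp [Nat.factorial]
  field_simp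
  ring

lemma G0 : Tendsto (fun x : ℝ => x * (1 - x) * (Real.log x - Real.log (1 - x)) ^ 3) (𝓝[>] 0) (𝓝 0) := by
  have hb : Tendsto (fun x : ℝ => Real.log (1 - x)) (𝓝[>] 0) (𝓝 0) := by
    have : ContinuousAt (fun x : ℝ => Real.log (1 - x)) 0 := by
      have : (1 - 0 : ℝ) ≠ 0 := by norm_num
      fun_prop (disch := assumption)
    have := this.tendsto
    simp at this
    exact this.mono_left nhdsWithin_le_nhds
  have hx : Tendsto (fun x : ℝ => x) (𝓝[>] 0) (𝓝 0) := tendsto_id.mono_left nhdsWithin_le_nhds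
  have h1 := tend_log 0 0
  have h2 := tend_log 1 0
  have h3 := tend_log 2 0
  have := ((((h3.sub ((h2.mul hb).const_mul 3)).add ((h1.mul (hb.pow 2)).const_mul 3)).sub (hx.mul (hb.pow 3)))).mul ((tendsto_const_nhds (x := (1:ℝ))).sub hx)
  norm_num at this
  refine this.congr fun x => ?_
  ring

lemma G1 : Tendsto (fun x : ℝ => x * (1 - x) * (Real.log x - Real.log (1 - x)) ^ 3) (𝓝[<] 1) (𝓝 0) := by
  have ht : Tendsto (fun x : ℝ => 1 - x) (𝓝[<] 1) (𝓝[>] 0) := by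
    refine tendsto_nhdsWithin_iff.2 ⟨?_, ?_⟩
    · have : ContinuousAt (fun x : ℝ => 1 - x) 1 := by fun_prop
      have := this.tendsto
      simp at this
      exact this.mono_left nhdsWithin_le_nhds
    · filter_upwards [self_mem_nhdsWithin] with x hx
      have hx : x < 1 := hx
      simp [hx]
  have := (G0.comp ht).neg
  rw [neg_zero] at this
  refine this.congr fun x => ?_
  simp only [Function.comp, sub_sub_cancel]
  ring

lemma ii_D1 : IntervalIntegrable (fun x => Real.log x - Real.log (1 - x)) volume 0 1 := by
  refine ((hi_of (ii_mon 1 0)).add ((hi_of (ii_mon 0 1)).smul (-1))).congr (d := _) ?_ rfl |>.1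
  intros; ring

lemma ii_D2 : IntervalIntegrable (fun x => (Real.log x - Real.log (1 - x)) ^ 2) volume 0 1 := by
  refine (((hi_of (ii_mon 2 0)).add ((hi_of (ii_mon 1 1)).smul (-2))).add (hi_of (ii_mon 0 2))).congr (d := _) ?_ rfl |>.1
  intros; ring

lemma ii_D3 : IntervalIntegrable (fun x => (Real.log x - Real.log (1 - x)) ^ 3) volume 0 1 := by
  refine ((((hi_of (ii_mon 3 0)).add ((hi_of (ii_mon 2 1)).smul (-3))).add
    ((hi_of (ii_mon 1 2)).smul 3)).add ((hi_of (ii_mon 0 3)).smul (-1))).congr (d := _) ?_ rfl |>.1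
  intros; ring

lemma G : HI (fun x => (1 - x) * ((Real.log x - Real.log (1 - x)) ^ 3 +
    3 * (Real.log x - Real.log (1 - x)) ^ 2)) 0 := by
  have hI := ii_mul (g := fun x => 1 - x) (by fun_prop) (ii_D3.add (ii_D2.const_mul 3))
  have hA := hi_of hI
  have hB := hA.add hA.symm
  have h0 := intervalIntegral.integral_eq_sub_of_hasDerivAt_of_tendsto (a := (0:ℝ)) (b := 1)
      (f := fun x : ℝ => x * (1 - x) * (Real.log x - Real.log (1 - x)) ^ 3) one_pos (fa := 0) (fb := 0)
      ?_ hB.1 G0 G1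
  · rw [hB.2] at h0
    exact hA.congr (fun _ _ _ => rfl) (by linarith)
  · rintro x ⟨h0, h1⟩
    have h1' : 0 < 1 - x := by linarith
    have hx := hasDerivAt_id x
    have hy := (hasDerivAt_const x (1:ℝ)).sub hx
    have := (hx.mul hy).mul (((Real.hasDerivAt_log h0.ne').sub (hy.log h1'.ne')).pow 3)
    refine this.congr_deriv ?_
    simp
    field_simp
    ring

lemma outer (J K : ℝ) : HI (fun x => (1 - x) * ((Real.log x - Real.log (1 - x)) ^ 3 +
    3 * (Real.log x - Real.log (1 - x)) ^ 2 + 6 * (J - 1) * (Real.log x - Real.log (1 - x))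
     - 12 - 3 * K)) (-3 * J - 3 - 3 / 2 * K) := by
  have a0 := hi_klog 0 0
  have a1 := hi_klog 1 0
  have a2 := hi_klog 0 1
  have a3 := hi_klog 1 1
  refine (((G.add ((a2.add (a3.smul (-1))).smul (6 * (J - 1)))).add (a3.symm.smul (-6 * (J - 1)))).add
    ((a0.add (a1.smul (-1))).smul (-12 - 3 * K))).congr ?_ ?_
  · intros; ring
  · norm_num; ring

lemma inner (D : ℝ) (ω : ℂ) (hω : ω ^ 2 + ω + 1 = 0) :
    ∫ t in (0:ℝ)..1, ((D : ℂ) + ω * (Real.log t : ℝ) + ω ^ 2 * (Real.log (1 - t) : ℝ)) ^ 3 =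
      ((D ^ 3 + 3 * D ^ 2 + 6 * ((∫ t in (0:ℝ)..1, Real.log t * Real.log (1 - t)) - 1) * D - 12
        - 3 * (∫ t in (0:ℝ)..1, Real.log t ^ 2 * Real.log (1 - t)) : ℝ) : ℂ) := by
  have hJ : HI (fun t => Real.log t * Real.log (1 - t)) (∫ t in (0:ℝ)..1, Real.log t * Real.log (1 - t)) :=
    hi_of (by simpa using ii_mon 1 1)
  have hK : HI (fun t => Real.log t ^ 2 * Real.log (1 - t)) (∫ t in (0:ℝ)..1, Real.log t ^ 2 * Real.log (1 - t)) :=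
    hi_of (by simpa using ii_mon 2 1)
  set J := ∫ t in (0:ℝ)..1, Real.log t * Real.log (1 - t)
  set K := ∫ t in (0:ℝ)..1, Real.log t ^ 2 * Real.log (1 - t)
  have a0 := hi_klog 0 0
  have a1 := hi_klog 0 1
  have a2 := hi_klog 0 2
  have a3 := hi_klog 0 3
  have r1 : HI (fun t => D ^ 3 + 6 * D * (Real.log t * Real.log (1 - t)) + Real.log t ^ 3 + Real.log (1 - t) ^ 3)
      (D ^ 3 + 6 * D * J - 12) := by
    refine ((((a0.smul (D ^ 3)).add (hJ.smul (6 * D))).add a3).add a3.symm).congr ?_ ?_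
    · intros; ring
    · norm_num [Nat.factorial]; ring
  have r2 : HI (fun t => 3 * D ^ 2 * Real.log t + 3 * D * Real.log (1 - t) ^ 2 + 3 * (Real.log t ^ 2 * Real.log (1 - t)))
      (- 3 * D ^ 2 + 6 * D + 3 * K) := by
    refine (((a1.smul (3 * D ^ 2)).add (a2.symm.smul (3 * D))).add (hK.smul 3)).congr ?_ ?_
    · intros; ring
    · norm_num [Nat.factorial]; ring
  have r3 := r2.symm
  simp only [sub_sub_cancel] at r3
  have w3 : ω ^ 3 = 1 := by linear_combination (ω - 1) * hω
  have e : ∀ t : ℝ, ((D : ℂ) + ω * (Real.log t : ℝ) + ω ^ 2 * (Real.log (1 - t) : ℝ)) ^ 3 =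
      ((D ^ 3 + 6 * D * (Real.log t * Real.log (1 - t)) + Real.log t ^ 3 + Real.log (1 - t) ^ 3 : ℝ) : ℂ)
      + ω * ((3 * D ^ 2 * Real.log t + 3 * D * Real.log (1 - t) ^ 2 + 3 * (Real.log t ^ 2 * Real.log (1 - t)) : ℝ) : ℂ)
      + ω ^ 2 * ((3 * D ^ 2 * Real.log (1 - t) + 3 * D * Real.log t ^ 2 + 3 * (Real.log (1 - t) ^ 2 * Real.log t) : ℝ) : ℂ) := by
    intro t
    generalize Real.log t = a
    generalize Real.log (1 - t) = b
    push_cast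
    have w4 : ω ^ 4 = ω := by linear_combination ω * w3
    have w5 : ω ^ 5 = ω ^ 2 := by linear_combination ω ^ 2 * w3
    have w6 : ω ^ 6 = 1 := by linear_combination (ω ^ 3 + 1) * w3
    ring_nf
    simp only [w3, w4, w5, w6]
    ring
  simp_rw [e]
  rw [intervalIntegral.integral_add, intervalIntegral.integral_add, intervalIntegral.integral_const_mul,
    intervalIntegral.integral_const_mul, intervalIntegral.integral_ofReal, intervalIntegral.integral_ofReal,
    intervalIntegral.integral_ofReal, r1.2, r2.2, r3.2]
  · push_cast
    linear_combination (- 3 * (D:ℂ) ^ 2 + 6 * D + 3 * K) * hω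
  · exact (HI.ofReal' r1)
  · exact (HI.ofReal' r2).const_mul _
  · exact (HI.ofReal' r1).add ((HI.ofReal' r2).const_mul _)
  · exact (HI.ofReal' r3).const_mul _

lemma inner' (x : ℝ) (h0 : 0 < x) (h1 : x < 1) (ω : ℂ) (hω : ω ^ 2 + ω + 1 = 0) :
    ∫ y in (0:ℝ)..(1 - x), (Complex.log x + ω * Complex.log y + ω ^ 2 * Complex.log (1 - x - y)) ^ 3
     = (((1 - x) * ((Real.log x - Real.log (1 - x)) ^ 3 +
    3 * (Real.log x - Real.log (1 - x)) ^ 2 + 6 * ((∫ t in (0:ℝ)..1, Real.log t * Real.log (1 - t)) - 1) * (Real.log x - Real.log (1 - x))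
     - 12 - 3 * (∫ t in (0:ℝ)..1, Real.log t ^ 2 * Real.log (1 - t))) : ℝ) : ℂ) := by
  have h1' : 0 < 1 - x := by linarith
  have h := intervalIntegral.smul_integral_comp_mul_left (a := 0) (b := 1)
    (fun y : ℝ => (Complex.log x + ω * Complex.log y + ω ^ 2 * Complex.log (1 - x - y)) ^ 3) (1 - x)
  rw [mul_zero, mul_one] at h
  rw [← h, Complex.ofReal_mul, ← inner _ ω hω, Complex.real_smul]
  congr 1
  apply intervalIntegral.integral_congr_uIoo
  intro t ht
  rw [uIoo_of_le zero_le_one] at ht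
  have ht' : 0 < 1 - t := by linarith [ht.2]
  have e : (1 : ℂ) - x - ((1 - x) * t : ℝ) = (((1 - x) * (1 - t) : ℝ) : ℂ) := by push_cast; ring
  simp only
  rw [e, ← Complex.ofReal_log h0.le, ← Complex.ofReal_log (by have := ht.1; positivity),
    ← Complex.ofReal_log (by positivity), Real.log_mul h1'.ne' ht.1.ne', Real.log_mul h1'.ne' ht'.ne']
  push_cast
  congr 1
  linear_combination (Real.log (1 - x) : ℂ) * hω

theorem statement18 :
    (∑' n : ℕ+, (1 : ℂ) / (n : ℂ) ^ 3) =
      -(1 / 3) * ∫ x in (0:ℝ)..1, ∫ y in (0:ℝ)..(1 - x),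
        (Complex.log x + Complex.exp (2 * Real.pi * Complex.I / 3) * Complex.log y +
            Complex.exp (2 * Real.pi * Complex.I / 3) ^ 2 * Complex.log (1 - x - y)) ^ 3 := by
  have hp : IsPrimitiveRoot (Complex.exp (2 * Real.pi * Complex.I / 3)) 3 := by
    simpa using Complex.isPrimitiveRoot_exp 3 (by norm_num)
  generalize Complex.exp (2 * Real.pi * Complex.I / 3) = ω at hp ⊢
  have hω : ω ^ 2 + ω + 1 = 0 := by
    have := hp.geom_sum_eq_zero (by norm_num)
    simp only [Finset.sum_range_succ, Finset.sum_range_zero] at this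
    linear_combination this
  have hin : EqOn (fun x : ℝ => ∫ y in (0:ℝ)..(1 - x), (Complex.log x + ω * Complex.log y + ω ^ 2 * Complex.log (1 - x - y)) ^ 3)
      (fun x : ℝ => (((1 - x) * ((Real.log x - Real.log (1 - x)) ^ 3 +
    3 * (Real.log x - Real.log (1 - x)) ^ 2 + 6 * ((∫ t in (0:ℝ)..1, Real.log t * Real.log (1 - t)) - 1) * (Real.log x - Real.log (1 - x))
     - 12 - 3 * (∫ t in (0:ℝ)..1, Real.log t ^ 2 * Real.log (1 - t))) : ℝ) : ℂ)) (uIoo 0 1) :=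
    fun x hx => by
      rw [uIoo_of_le zero_le_one] at hx
      exact inner' x hx.1 hx.2 ω hω
  rw [intervalIntegral.integral_congr_uIoo hin, intervalIntegral.integral_ofReal, (outer _ _).2]
  have hs := JK
  set J := ∫ t in (0:ℝ)..1, Real.log t * Real.log (1 - t)
  set K := ∫ t in (0:ℝ)..1, Real.log t ^ 2 * Real.log (1 - t)
  have hf : HasSum (fun k : ℕ => 1 / ((k:ℝ) + 1) ^ 3) (J + K / 2 + 1) := by
    have := (hasSum_nat_add_iff (f := fun k : ℕ => 1 / ((k:ℝ) + 1) ^ 3) (g := J + K / 2) 1).1 (by simpa using hs)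
    simpa using this
  have hc := Complex.hasSum_ofReal.2 hf
  rw [tsum_pnat_eq_tsum_succ (f := fun n : ℕ => (1 : ℂ) / (n : ℂ) ^ 3)]
  push_cast at hc ⊢
  rw [hc.tsum_eq]
  ring
end
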